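/- The set of points x ∈ [0,1] at which f fails to be injective, namely G = {x ∈ [0,1] : there exists x' ∈ [0,1] with x' ≠ x and f(x') = f(x)}, is countable. -/

import Mathlib

open Filter MeasureTheory Finset

/-- The "beta" values `β₀ = 0`, `β₁ = p₀`, `β₂ = p₀ + p₁` associated with weights `p`. -/
noncomputable def P3beta (p : Fin 3 → ℝ) : Fin 3 → ℝ := ![0, p 0, p 0 + p 1]

/-- The P₃-value of a digit sequence `i : ℕ → Fin 3` (0-indexed):
`val(i) = β_{i₀} + Σ_{k≥1} β_{i_k} ∏_{r<k} p_{i_r}`. -/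
noncomputable def P3val (p : Fin 3 → ℝ) (i : ℕ → Fin 3) : ℝ :=
  ∑' k : ℕ, P3beta p (i k) * ∏ r ∈ Finset.range k, p (i r)

/-- The digit permutation θ with θ(0)=0, θ(1)=2, θ(2)=1. -/
def P3theta : Fin 3 → Fin 3 := ![0, 2, 1]

/-- The one-sided shift on digit sequences. -/
def P3shift (i : ℕ → Fin 3) : ℕ → Fin 3 := fun k => i (k + 1)

section Digits

variable {p : Fin 3 → ℝ}

lemma P3beta_nonneg (hp : ∀ t, 0 < p t) (t : Fin 3) : 0 ≤ P3beta p t := by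
  have h0 := hp 0
  have h1 := hp 1
  fin_cases t <;> simp [P3beta] <;> linarith

lemma P3beta_add_le_one (hp : ∀ t, 0 < p t) (hsum : p 0 + p 1 + p 2 = 1) (t : Fin 3) :
    P3beta p t + p t ≤ 1 := by
  have h1 := hp 1
  have h2 := hp 2
  fin_cases t <;> simp [P3beta] <;> linarith

lemma P3beta_add_le_of_lt (hp : ∀ t, 0 < p t) {s t : Fin 3} (hst : s < t) :
    P3beta p s + p s ≤ P3beta p t := by
  have h1 := hp 1
  fin_cases s <;> fin_cases t <;> simp [P3beta] at hst ⊢ <;> linarith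

lemma eq_zero_of_P3beta_eq_zero (hp : ∀ t, 0 < p t) {t : Fin 3} (ht : P3beta p t = 0) :
    t = 0 := by
  have h0 := hp 0
  have h1 := hp 1
  fin_cases t <;> simp [P3beta] at ht ⊢ <;> linarith

lemma eq_two_of_P3beta_add_eq_one (hp : ∀ t, 0 < p t) (hsum : p 0 + p 1 + p 2 = 1) {t : Fin 3}
    (ht : P3beta p t + p t = 1) : t = 2 := by
  have h1 := hp 1
  have h2 := hp 2
  fin_cases t <;> simp [P3beta] at ht ⊢ <;> linarith

lemma P3val_term_nonneg (hp : ∀ t, 0 < p t) (a : ℕ → Fin 3) (k : ℕ) :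
    0 ≤ P3beta p (a k) * ∏ r ∈ range k, p (a r) :=
  mul_nonneg (P3beta_nonneg hp _) (prod_nonneg fun _ _ => (hp _).le)

lemma P3val_partial_sum_le_one (hp : ∀ t, 0 < p t) (hsum : p 0 + p 1 + p 2 = 1)
    (a : ℕ → Fin 3) (n : ℕ) :
    ∑ k ∈ range n, P3beta p (a k) * ∏ r ∈ range k, p (a r) ≤ 1 := by
  suffices ∑ k ∈ range n, P3beta p (a k) * ∏ r ∈ range k, p (a r) + ∏ r ∈ range n, p (a r) ≤ 1 by
    have : 0 ≤ ∏ r ∈ range n, p (a r) := prod_nonneg fun _ _ => (hp _).le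
    linarith
  induction n with
  | zero => simp
  | succ n ih =>
    rw [sum_range_succ, prod_range_succ]
    have : 0 ≤ ∏ r ∈ range n, p (a r) := prod_nonneg fun _ _ => (hp _).le
    nlinarith [mul_le_mul_of_nonneg_right (P3beta_add_le_one hp hsum (a n)) this]

lemma P3val_summable (hp : ∀ t, 0 < p t) (hsum : p 0 + p 1 + p 2 = 1) (a : ℕ → Fin 3) :
    Summable fun k => P3beta p (a k) * ∏ r ∈ range k, p (a r) :=
  summable_of_sum_range_le (P3val_term_nonneg hp a) (P3val_partial_sum_le_one hp hsum a)

lemma P3val_nonneg (hp : ∀ t, 0 < p t) (a : ℕ → Fin 3) : 0 ≤ P3val p a :=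
  tsum_nonneg (P3val_term_nonneg hp a)

lemma P3val_le_one (hp : ∀ t, 0 < p t) (hsum : p 0 + p 1 + p 2 = 1) (a : ℕ → Fin 3) :
    P3val p a ≤ 1 :=
  Real.tsum_le_of_sum_range_le (P3val_term_nonneg hp a) (P3val_partial_sum_le_one hp hsum a)

lemma P3val_eq_add_shift (hp : ∀ t, 0 < p t) (hsum : p 0 + p 1 + p 2 = 1) (a : ℕ → Fin 3) :
    P3val p a = P3beta p (a 0) + p (a 0) * P3val p (P3shift a) := by
  rw [P3val, (P3val_summable hp hsum a).tsum_eq_zero_add, P3val, ← tsum_mul_left]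
  simp only [prod_range_zero, mul_one, prod_range_succ', P3shift]
  congr 2
  ext k
  ring

lemma eq_zero_of_P3val_eq_zero (hp : ∀ t, 0 < p t) (hsum : p 0 + p 1 + p 2 = 1)
    {a : ℕ → Fin 3} (ha : P3val p a = 0) (k : ℕ) : a k = 0 := by
  induction k generalizing a with
  | zero =>
    have hrec := P3val_eq_add_shift hp hsum a
    have hb := P3beta_nonneg hp (a 0)
    have hv := mul_nonneg (hp (a 0)).le (P3val_nonneg hp (P3shift a))
    exact eq_zero_of_P3beta_eq_zero hp (by linarith)
  | succ k ih =>
    have hrec := P3val_eq_add_shift hp hsum a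
    have hb := P3beta_nonneg hp (a 0)
    have hv := mul_nonneg (hp (a 0)).le (P3val_nonneg hp (P3shift a))
    exact ih (a := P3shift a) (mul_left_cancel₀ (hp (a 0)).ne' (by linarith))

lemma eq_two_of_P3val_eq_one (hp : ∀ t, 0 < p t) (hsum : p 0 + p 1 + p 2 = 1)
    {a : ℕ → Fin 3} (ha : P3val p a = 1) (k : ℕ) : a k = 2 := by
  induction k generalizing a with
  | zero =>
    have hrec := P3val_eq_add_shift hp hsum a
    have hb := P3beta_add_le_one hp hsum (a 0)
    have hv := mul_le_mul_of_nonneg_left (P3val_le_one hp hsum (P3shift a)) (hp (a 0)).le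
    exact eq_two_of_P3beta_add_eq_one hp hsum (by linarith)
  | succ k ih =>
    have hrec := P3val_eq_add_shift hp hsum a
    have hb := P3beta_add_le_one hp hsum (a 0)
    have hv := mul_le_mul_of_nonneg_left (P3val_le_one hp hsum (P3shift a)) (hp (a 0)).le
    exact ih (a := P3shift a) (mul_left_cancel₀ (hp (a 0)).ne' (by linarith))

lemma eventuallyConst_of_shift_eq {a : ℕ → Fin 3} {c : Fin 3} (h : ∀ k, P3shift a k = c) :
    EventuallyConst a atTop :=
  eventuallyConst_atTop_nat.2 ⟨1, fun m hm => by
    obtain ⟨k, rfl⟩ := Nat.exists_eq_add_of_le' hm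
    exact (h (k + 1)).trans (h k).symm⟩

lemma eventuallyConst_of_P3val_eq_of_lt (hp : ∀ t, 0 < p t) (hsum : p 0 + p 1 + p 2 = 1)
    {a b : ℕ → Fin 3} (h : P3val p a = P3val p b) (hlt : a 0 < b 0) :
    EventuallyConst a atTop ∧ EventuallyConst b atTop := by
  have hle := P3beta_add_le_of_lt hp hlt
  have hva := mul_le_mul_of_nonneg_left (P3val_le_one hp hsum (P3shift a)) (hp (a 0)).le
  have hvb := mul_nonneg (hp (b 0)).le (P3val_nonneg hp (P3shift b))
  rw [P3val_eq_add_shift hp hsum a, P3val_eq_add_shift hp hsum b] at h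
  have ha : P3val p (P3shift a) = 1 := mul_left_cancel₀ (hp (a 0)).ne' (by linarith)
  have hb : P3val p (P3shift b) = 0 := mul_left_cancel₀ (hp (b 0)).ne' (by linarith)
  exact ⟨eventuallyConst_of_shift_eq (eq_two_of_P3val_eq_one hp hsum ha),
    eventuallyConst_of_shift_eq (eq_zero_of_P3val_eq_zero hp hsum hb)⟩

lemma eventuallyConst_of_shift {a : ℕ → Fin 3} (h : EventuallyConst (P3shift a) atTop) :
    EventuallyConst a atTop := by
  obtain ⟨n, hn⟩ := eventuallyConst_atTop_nat.1 h
  refine eventuallyConst_atTop_nat.2 ⟨n + 1, fun m hm => ?_⟩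
  obtain ⟨k, rfl⟩ := Nat.exists_eq_add_of_le' hm
  exact hn (k + n) (by lia)

/-- Two different digit sequences with the same value are both eventually constant. -/
lemma eventuallyConst_of_P3val_eq (hp : ∀ t, 0 < p t) (hsum : p 0 + p 1 + p 2 = 1)
    {a b : ℕ → Fin 3} (h : P3val p a = P3val p b) (hne : a ≠ b) :
    EventuallyConst a atTop ∧ EventuallyConst b atTop := by
  obtain ⟨n, hn⟩ := Function.ne_iff.1 hne
  clear hne
  induction n generalizing a b with
  | zero =>
    rcases lt_or_gt_of_ne hn with hlt | hlt
    · exact eventuallyConst_of_P3val_eq_of_lt hp hsum h hlt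
    · exact (eventuallyConst_of_P3val_eq_of_lt hp hsum h.symm hlt).symm
  | succ n ih =>
    rcases lt_trichotomy (a 0) (b 0) with hlt | heq | hlt
    · exact eventuallyConst_of_P3val_eq_of_lt hp hsum h hlt
    · rw [P3val_eq_add_shift hp hsum a, P3val_eq_add_shift hp hsum b, heq] at h
      have := ih (mul_left_cancel₀ (hp (b 0)).ne' (add_left_cancel h)) hn
      exact this.imp eventuallyConst_of_shift eventuallyConst_of_shift
    · exact (eventuallyConst_of_P3val_eq_of_lt hp hsum h.symm hlt).symm

end Digits

lemma countable_setOf_eventuallyConst (α : Type*) [Countable α] :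
    {a : ℕ → α | EventuallyConst a atTop}.Countable := by
  refine (Set.countable_range fun (q : List α × α) k => q.1.getD k q.2).mono fun a ha => ?_
  obtain ⟨n, hn⟩ := eventuallyConst_atTop.1 ha
  refine ⟨((List.range n).map a, a n), funext fun k => ?_⟩
  rcases lt_or_ge k n with hk | hk
  · simp [List.getD, hk]
  · simp [List.getD, hk, hn k hk]

lemma P3theta_involutive : Function.Involutive P3theta := by
  intro t
  fin_cases t <;> rfl

theorem stmt4 (p : Fin 3 → ℝ) (hp : ∀ t, p t ∈ Set.Ioo (0 : ℝ) 1)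
    (hsum : p 0 + p 1 + p 2 = 1)
    (f : ℝ → ℝ)
    (hf : ∀ i : ℕ → Fin 3, (¬ ∃ N, ∀ k ≥ N, i k = 2) →
      f (P3val p i) = P3val p (fun k => P3theta (i k)))
    (hrep : ∀ x ∈ Set.Ico (0 : ℝ) 1, ∃ i : ℕ → Fin 3,
      (¬ ∃ N, ∀ k ≥ N, i k = 2) ∧ P3val p i = x) :
    Set.Countable {x ∈ Set.Icc (0 : ℝ) 1 | ∃ x' ∈ Set.Icc (0 : ℝ) 1, x' ≠ x ∧ f x' = f x} := by
  have hpos : ∀ t, 0 < p t := fun t => (hp t).1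
  set E := P3val p '' {a : ℕ → Fin 3 | EventuallyConst a atTop}
  have hE : E.Countable := (countable_setOf_eventuallyConst _).image _
  have hinj : ∀ x ∈ Set.Ico (0 : ℝ) 1, ∀ y ∈ Set.Ico (0 : ℝ) 1, f x = f y → x ∉ E → x = y := by
    intro x hx y hy hxy hxE
    obtain ⟨i, hi, rfl⟩ := hrep x hx
    obtain ⟨j, hj, rfl⟩ := hrep y hy
    rw [hf i hi, hf j hj] at hxy
    by_contra hne
    have hij : (fun k => P3theta (i k)) ≠ fun k => P3theta (j k) := fun h =>
      hne (congrArg _ (funext fun k => P3theta_involutive.injective (congrFun h k)))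
    have hc := (eventuallyConst_of_P3val_eq hpos hsum hxy hij).1.comp P3theta
    refine hxE ⟨i, ?_, rfl⟩
    simpa [Function.comp_def, P3theta_involutive _] using hc
  have hfib : {x ∈ Set.Ico (0 : ℝ) 1 | f x = f 1 ∧ x ∉ E}.Subsingleton :=
    fun x hx y hy => hinj x hx.1 y hy.1 (hx.2.1.trans hy.2.1.symm) hx.2.2
  refine ((hE.union hfib.countable).insert 1).mono ?_
  rintro x ⟨hx, y, hy, hne, hyx⟩
  by_cases hx1 : x = 1
  · exact Or.inl hx1
  by_cases hxE : x ∈ E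
  · exact Or.inr (Or.inl hxE)
  have hx' : x ∈ Set.Ico (0 : ℝ) 1 := ⟨hx.1, hx.2.lt_of_ne hx1⟩
  by_cases hy1 : y = 1
  · exact Or.inr (Or.inr ⟨hx', hy1 ▸ hyx.symm, hxE⟩)
  · exact absurd (hinj x hx' y ⟨hy.1, hy.2.lt_of_ne hy1⟩ hyx.symm hxE).symm hne
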